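/- Every β ∈ Q with σ(β) ∉ Q has finite Levi order q^σ(β) if and only if for every β ∈ Q with σ(β) ∉ Q there exists α ∈ R with ξ(α) > 0 and ξ(σ(α)) ≤ 0 such that β + α ∈ R and ξ(σ(β + α)) > 0. -/

import Mathlib

open RealInnerProductSpace

variable {V : Type*} [NormedAddCommGroup V] [InnerProductSpace ℝ V]

/-- `R` is a reduced crystallographic root system in `V`. -/
def IsRootSystem (R : Set V) : Prop :=
  R.Finite ∧ (0 : V) ∉ R ∧
    (∀ α ∈ R, ∀ β ∈ R,
      (∃ n : ℤ, 2 * ⟪β, α⟫ / ⟪α, α⟫ = (n : ℝ)) ∧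
        β - (2 * ⟪β, α⟫ / ⟪α, α⟫) • α ∈ R) ∧
    ∀ α ∈ R, ∀ t : ℝ, t • α ∈ R → t = 1 ∨ t = -1

/-- The partial sum `β + α₁ + ⋯ + α_h` of the first `h` terms of a sequence. -/
def partialSum (β : V) {k : ℕ} (α : Fin k → V) (h : ℕ) : V :=
  β + ∑ i ∈ Finset.univ.filter (fun i : Fin k => (i : ℕ) < h), α i

/-- `α` is a Levi chain of length `k` for `β`: all `σ(αᵢ) ∈ Q`, all partial sums
`β + α₁ + ⋯ + α_h` (`1 ≤ h ≤ k`) are roots, and the final sum `γ` satisfies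
`γ ∉ Q` and `σ(γ) ∉ Q`. -/
def IsLeviChain (R Q : Set V) (σ : V →ₗ[ℝ] V) (β : V) {k : ℕ} (α : Fin k → V) : Prop :=
  (∀ i, α i ∈ R ∧ σ (α i) ∈ Q) ∧
    (∀ h : ℕ, 1 ≤ h → h ≤ k → partialSum β α h ∈ R) ∧
    partialSum β α k ∉ Q ∧ σ (partialSum β α k) ∉ Q

/-- The Levi order `q^σ(β)`: the minimal length of a Levi chain for `β`,
or `⊤` if no Levi chain for `β` exists. -/
noncomputable def leviOrder (R Q : Set V) (σ : V →ₗ[ℝ] V) (β : V) : ℕ∞ :=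
  sInf {m : ℕ∞ | ∃ (k : ℕ) (α : Fin k → V), m = (k : ℕ∞) ∧ IsLeviChain R Q σ β α}

/-- Two roots at an obtuse angle that are not opposite add up to a root. -/
lemma IsRootSystem.add_mem_of_inner_neg {R : Set V} (hR : IsRootSystem R) {α β : V}
    (hα : α ∈ R) (hβ : β ∈ R) (h : ⟪α, β⟫ < 0) (hne : α + β ≠ 0) : α + β ∈ R := by
  obtain ⟨-, h0, hrefl, -⟩ := hR
  have hpos : ∀ x ∈ R, 0 < ⟪x, x⟫ := fun x hx =>
    real_inner_self_pos.mpr fun hx0 => h0 (hx0 ▸ hx)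
  have coeff : ∀ x ∈ R, ∀ y ∈ R, ⟪x, y⟫ < 0 → x + y ∈ R ∨ ⟪x, x⟫ ≤ -⟪x, y⟫ := by
    intro x hx y hy hxy
    obtain ⟨⟨n, hn⟩, hmem⟩ := hrefl x hx y hy
    have hxx := hpos x hx
    rw [real_inner_comm] at hn hmem
    have hn' : 2 * ⟪x, y⟫ = n * ⟪x, x⟫ := by
      rw [← hn]; field_simp
    have hneg : n < 0 := by
      have : (n : ℝ) < 0 := by
        by_contra! hc
        nlinarith [mul_nonneg hc hxx.le]
      exact_mod_cast this
    rcases eq_or_ne n (-1) with h1 | h1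
    · left
      rw [hn, h1] at hmem
      simpa [add_comm] using hmem
    · right
      have : (n : ℝ) ≤ -2 := by
        have : n ≤ -2 := by omega
        exact_mod_cast this
      nlinarith
  rcases coeff α hα β hβ h with h1 | h1
  · exact h1
  rcases coeff β hβ α hα (by rwa [real_inner_comm]) with h2 | h2
  · rwa [add_comm]
  · rw [real_inner_comm α β] at h2
    have := real_inner_self_pos.mpr hne
    rw [real_inner_add_add_self] at this
    linarith

lemma IsRootSystem.neg_mem {R : Set V} (hR : IsRootSystem R) {α : V} (hα : α ∈ R) :
    -α ∈ R := by
  obtain ⟨-, h0, hrefl, -⟩ := hR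
  have hpos : ⟪α, α⟫ ≠ 0 := inner_self_ne_zero.mpr fun hx0 => h0 (hx0 ▸ hα)
  have := (hrefl α hα α hα).2
  rw [mul_div_assoc, div_self hpos] at this
  convert this using 1
  module

/-- If `x`, `y`, `z`, `x + y` and `x + y + z` are roots, then `x + z` or `y + z` is a root
or zero. -/
lemma IsRootSystem.add_mem_or_add_mem {R : Set V} (hR : IsRootSystem R) {x y z : V}
    (hx : x ∈ R) (hy : y ∈ R) (hz : z ∈ R) (hxy : x + y ∈ R) (hxyz : x + y + z ∈ R) :
    x + z ∈ R ∨ x + z = 0 ∨ y + z ∈ R ∨ y + z = 0 := by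
  by_contra! ⟨h1, h2, h3, h4⟩
  have key : ∀ {a b : V}, a ∈ R → b ∈ R → a + b ∉ R → a + b ≠ 0 → 0 ≤ ⟪a, b⟫ := by
    intro a b ha hb hab hab0
    by_contra! hlt
    exact hab (hR.add_mem_of_inner_neg ha hb hlt hab0)
  have e1 : x + y + z + -x = y + z := by abel
  have e2 : x + y + z + -y = x + z := by abel
  have i1 := key hxyz (hR.neg_mem hx) (e1 ▸ h3) (e1 ▸ h4)
  have i2 := key hxyz (hR.neg_mem hy) (e2 ▸ h1) (e2 ▸ h2)
  have i3 := key hx hz h1 h2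
  have i4 := key hy hz h3 h4
  have i5 : 0 < ⟪x + y, x + y⟫ :=
    real_inner_self_pos.mpr fun h => hR.2.1 (h ▸ hxy)
  simp only [inner_add_left, inner_add_right, inner_neg_right] at i1 i2 i5
  rw [real_inner_comm x z] at i1
  rw [real_inner_comm y z] at i2
  rw [real_inner_comm x y] at i1 i5
  linarith [real_inner_comm x y, real_inner_comm x z, real_inner_comm y z]

/-- `γ` is obtained from `β` by successively adding `n` elements of `S`, every new partial sum
lying in `R`. -/
def Reachable (R S : Set V) : ℕ → V → V → Prop
  | 0, β, γ => β = γ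
  | n + 1, β, γ => ∃ a ∈ S, β + a ∈ R ∧ Reachable R S n (β + a) γ

lemma Reachable.apply_le {R S : Set V} {η : V →ₗ[ℝ] ℝ} (hS : ∀ a ∈ S, η a ≤ 0) {n : ℕ}
    {β γ : V} (h : Reachable R S n β γ) : η γ ≤ η β := by
  induction n generalizing β with
  | zero => rw [show β = γ from h]
  | succ n ih =>
    obtain ⟨a, ha, -, h⟩ := h
    have := ih h
    rw [map_add] at this
    linarith [hS a ha]

/-- If `ξ` increases along a path whose steps lie in `{η ≤ 0}` and which stays in `{0 < η}`,
the path can be rearranged, without becoming longer, so that `ξ` is positive on its first step. -/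
lemma Reachable.exists_first_step_pos {R : Set V} (hR : IsRootSystem R) {ξ η : V →ₗ[ℝ] ℝ}
    {n : ℕ} {β γ : V} (hβ : β ∈ R) (h : Reachable R {a ∈ R | η a ≤ 0} n β γ)
    (hη : 0 < η γ) (hξ : ξ β < ξ γ) :
    ∃ a ∈ R, 0 < ξ a ∧ η a ≤ 0 ∧ β + a ∈ R ∧
      ∃ m < n, Reachable R {a ∈ R | η a ≤ 0} m (β + a) γ := by
  induction n using Nat.strong_induction_on generalizing β with
  | _ n ih =>
  cases n with
  | zero => exact absurd hξ (by rw [show β = γ from h]; exact lt_irrefl _)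
  | succ n =>
    have hS : ∀ a ∈ {a ∈ R | η a ≤ 0}, η a ≤ 0 := fun a ha => ha.2
    have shorten : ∀ m < n + 1, Reachable R {a ∈ R | η a ≤ 0} m β γ →
        ∃ a ∈ R, 0 < ξ a ∧ η a ≤ 0 ∧ β + a ∈ R ∧
          ∃ m < n + 1, Reachable R {a ∈ R | η a ≤ 0} m (β + a) γ := by
      intro m hm hreach
      obtain ⟨b, hb, h1, h2, h3, l, hl, h4⟩ := ih m hm hβ hreach hξ
      exact ⟨b, hb, h1, h2, h3, l, hl.trans hm, h4⟩
    obtain ⟨a, ⟨haR, haη⟩, hβa, h⟩ := h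
    rcases lt_or_ge 0 (ξ a) with ha | ha
    · exact ⟨a, haR, ha, haη, hβa, n, n.lt_succ_self, h⟩
    obtain ⟨b, hbR, hbξ, hbη, hβab, m, hm, hreach⟩ :=
      ih n n.lt_succ_self hβa h (by rw [map_add]; linarith)
    have hpos := hη.trans_le (hreach.apply_le hS)
    simp only [map_add] at hpos
    rcases hR.add_mem_or_add_mem hβ haR hbR hβa hβab with h1 | h1 | h1 | h1
    · refine ⟨b, hbR, hbξ, hbη, h1, m + 1, by omega, a, ⟨haR, haη⟩, ?_, ?_⟩ <;>
        rwa [add_right_comm]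
    · have := congrArg η h1
      rw [map_add, map_zero] at this
      linarith
    · rw [add_assoc] at hβab hreach
      exact shorten (m + 1) (by omega)
        ⟨a + b, ⟨h1, by rw [map_add]; linarith⟩, hβab, hreach⟩
    · rw [add_assoc, h1, add_zero] at hreach
      exact shorten m (by omega) hreach

lemma partialSum_zero (β : V) {k : ℕ} (α : Fin k → V) : partialSum β α 0 = β := by
  simp [partialSum]

lemma partialSum_succ (β : V) {k : ℕ} (α : Fin (k + 1) → V) (h : ℕ) :
    partialSum β α (h + 1) = partialSum (β + α 0) (Fin.tail α) h := by
  simp [partialSum, Finset.sum_filter, Fin.sum_univ_succ, Fin.tail, add_assoc]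

lemma reachable_iff_exists_partialSum {R S : Set V} {k : ℕ} {β γ : V} :
    Reachable R S k β γ ↔ ∃ α : Fin k → V, (∀ i, α i ∈ S) ∧
      (∀ h : ℕ, 1 ≤ h → h ≤ k → partialSum β α h ∈ R) ∧ partialSum β α k = γ := by
  induction k generalizing β with
  | zero =>
    constructor
    · intro h
      exact ⟨Fin.elim0, fun i => i.elim0, fun h h1 h2 => by omega,
        (partialSum_zero _ _).trans h⟩
    · rintro ⟨α, -, -, h⟩
      exact (partialSum_zero _ _).symm.trans h
  | succ k ih =>
    constructor
    · rintro ⟨a, ha, hβa, hreach⟩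
      obtain ⟨α, hα, hsum, hγ⟩ := ih.mp hreach
      refine ⟨Fin.cons a α, Fin.cases ha hα, ?_, ?_⟩
      · rintro (_ | _ | h) h1 h2
        · omega
        · simpa [partialSum_succ, partialSum_zero] using hβa
        · rw [partialSum_succ, Fin.tail_cons, Fin.cons_zero]
          exact hsum _ (by omega) (by omega)
      · rwa [partialSum_succ, Fin.tail_cons, Fin.cons_zero]
    · rintro ⟨α, hα, hsum, hγ⟩
      refine ⟨α 0, hα 0, ?_, ih.mpr ⟨Fin.tail α, fun i => hα i.succ, ?_, ?_⟩⟩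
      · simpa [partialSum_succ, partialSum_zero] using hsum 1 le_rfl (by omega)
      · intro h h1 h2
        rw [← partialSum_succ]
        exact hsum _ (by omega) (by omega)
      · rwa [← partialSum_succ]

lemma Reachable.mem {R S : Set V} {n : ℕ} {β γ : V} (hβ : β ∈ R)
    (h : Reachable R S n β γ) : γ ∈ R := by
  induction n generalizing β with
  | zero => exact (show β = γ from h) ▸ hβ
  | succ n ih =>
    obtain ⟨a, -, ha, h⟩ := h
    exact ih ha h

lemma leviOrder_ne_top_iff_reachable {R : Set V} {ξ : V →ₗ[ℝ] ℝ} {σ : V →ₗ[ℝ] V}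
    (hσ : ∀ α ∈ R, σ α ∈ R) {β : V} (hβ : β ∈ R) :
    leviOrder R {α ∈ R | ξ α ≤ 0} σ β ≠ ⊤ ↔
      ∃ k γ, Reachable R {a ∈ R | (ξ ∘ₗ σ) a ≤ 0} k β γ ∧ 0 < ξ γ ∧ 0 < (ξ ∘ₗ σ) γ := by
  have hex : leviOrder R {α ∈ R | ξ α ≤ 0} σ β ≠ ⊤ ↔
      ∃ (k : ℕ) (α : Fin k → V), IsLeviChain R {α ∈ R | ξ α ≤ 0} σ β α := by
    rw [leviOrder, Ne, sInf_eq_top]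
    push Not
    constructor
    · rintro ⟨_, ⟨k, α, rfl, h⟩, -⟩
      exact ⟨k, α, h⟩
    · rintro ⟨k, α, h⟩
      exact ⟨k, ⟨k, α, rfl, h⟩, ENat.natCast_ne_top k⟩
  rw [hex]
  constructor
  · rintro ⟨k, α, hα, hsum, h1, h2⟩
    have hreach : Reachable R {a ∈ R | (ξ ∘ₗ σ) a ≤ 0} k β (partialSum β α k) :=
      reachable_iff_exists_partialSum.mpr ⟨α, fun i => ⟨(hα i).1, (hα i).2.2⟩, hsum, rfl⟩
    have hγ := hreach.mem hβ
    exact ⟨k, _, hreach, not_le.mp fun h => h1 ⟨hγ, h⟩, not_le.mp fun h => h2 ⟨hσ _ hγ, h⟩⟩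
  · rintro ⟨k, γ, hreach, h1, h2⟩
    obtain ⟨α, hα, hsum, rfl⟩ := reachable_iff_exists_partialSum.mp hreach
    exact ⟨k, α, fun i => ⟨(hα i).1, hσ _ (hα i).1, (hα i).2⟩, hsum,
      fun h => h1.not_ge h.2, fun h => h2.not_ge h.2⟩

/-- Every `β ∈ Q` with `σ(β) ∉ Q` has finite Levi order if and only if for every
such `β` there is `α ∈ R` with `ξ(α) > 0`, `ξ(σ(α)) ≤ 0`, `β + α ∈ R` and
`ξ(σ(β + α)) > 0`. -/
theorem leviOrder_finite_iff
    (R : Set V) (hR : IsRootSystem R)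
    (ξ : V →ₗ[ℝ] ℝ) (hξ : ∀ α ∈ R, ∃ n : ℤ, ξ α = (n : ℝ))
    (Q : Set V) (hQ : Q = {α ∈ R | ξ α ≤ 0})
    (σ : V →ₗ[ℝ] V) (hσ : σ ∘ₗ σ = LinearMap.id) (hσR : σ '' R = R) :
    (∀ β ∈ Q, σ β ∉ Q → leviOrder R Q σ β ≠ ⊤) ↔
      (∀ β ∈ Q, σ β ∉ Q →
        ∃ α ∈ R, 0 < ξ α ∧ ξ (σ α) ≤ 0 ∧ β + α ∈ R ∧ 0 < ξ (σ (β + α))) := by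
  subst hQ
  have hσmem : ∀ α ∈ R, σ α ∈ R := fun α hα => hσR ▸ Set.mem_image_of_mem σ hα
  constructor
  · rintro H β ⟨hβ, hβξ⟩ hσβ
    obtain ⟨k, γ, hreach, hξγ, hηγ⟩ :=
      (leviOrder_ne_top_iff_reachable hσmem hβ).mp (H β ⟨hβ, hβξ⟩ hσβ)
    obtain ⟨a, ha, haξ, haη, hβa, m, -, hm⟩ :=
      hreach.exists_first_step_pos hR hβ hηγ (hβξ.trans_lt hξγ)
    exact ⟨a, ha, haξ, haη, hβa, hηγ.trans_le (hm.apply_le fun a ha => ha.2)⟩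
  · intro H
    have main : ∀ n : ℕ, ∀ β ∈ R, 0 < ξ (σ β) → 0 < ξ β + n →
        ∃ k γ, Reachable R {a ∈ R | (ξ ∘ₗ σ) a ≤ 0} k β γ ∧ 0 < ξ γ ∧ 0 < (ξ ∘ₗ σ) γ := by
      intro n
      induction n with
      | zero => exact fun β _ hη hξ => ⟨0, β, rfl, by simpa using hξ, hη⟩
      | succ n ih =>
        intro β hβ hη hn
        rcases lt_or_ge 0 (ξ β) with hpos | hnonpos
        · exact ⟨0, β, rfl, hpos, hη⟩
        obtain ⟨a, ha, haξ, haη, hβa, hηa⟩ := H β ⟨hβ, hnonpos⟩ fun h => hη.not_ge h.2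
        obtain ⟨j, hj⟩ := hξ a ha
        have hone : (1 : ℝ) ≤ ξ a := by
          rw [hj] at haξ ⊢
          exact_mod_cast haξ
        obtain ⟨k, γ, hreach, hγ⟩ := ih (β + a) hβa hηa (by
          rw [map_add]
          push_cast at hn
          linarith)
        exact ⟨k + 1, γ, ⟨a, ⟨ha, haη⟩, hβa, hreach⟩, hγ⟩
    rintro β ⟨hβ, -⟩ hσβ
    obtain ⟨n, hn⟩ := exists_nat_gt (-ξ β)
    exact (leviOrder_ne_top_iff_reachable hσmem hβ).mpr
      (main n β hβ (not_le.mp fun h => hσβ ⟨hσmem β hβ, h⟩) (by linarith))
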